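/- Let T = {(i,j,k) : 0 ≤ i < j < k ≤ 4} (a set of 10 triples). Let 𝒜 be the set of pairs (a, b) where a : T → ℂ satisfies a(i,j,k) = 1 whenever k ≤ 3 and a(0,1,4) = 1, and b = (b₀,…,b₄) ∈ (ℂ∖{0})⁵. Define F(a,b) : T → ℂ by F(a,b)(i,j,k) = a(i,j,k)·bᵢ·bⱼ·b_k. Then: (1) (injectivity up to scalar) if (a,b), (a′,b′) ∈ 𝒜 and λ ∈ ℂ∖{0} satisfy F(a,b) = λ·F(a′,b′), then a = a′ and there exists μ ∈ ℂ∖{0} with bᵢ = μ·b′ᵢ for all i; (2) (surjectivity) for every A : T → ℂ with A(i,j,k) ≠ 0 whenever k ≤ 3 and A(0,1,4) ≠ 0, there exist (a,b) ∈ 𝒜 and λ ∈ ℂ∖{0} with A = λ·F(a,b). (This is the key step in the paper's proof that the space of cubic surfaces with an ordered inscribed complete pentahedron is birationally parametrized by PGL₄ × 𝒜₉.) -/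

import Mathlib

noncomputable section

/-- The set `T` of strictly increasing triples `(i,j,k)` with `0 ≤ i < j < k ≤ 4`. -/
def Triple : Type := {t : Fin 5 × Fin 5 × Fin 5 // t.1 < t.2.1 ∧ t.2.1 < t.2.2}

/-- The triple `(0,1,4)`. -/
def t014 : Triple := ⟨(0, 1, 4), by decide⟩

/-- The normalization conditions of the set `𝒜` (the paper's `𝒜₉`): `a(i,j,k) = 1`
whenever `k ≤ 3`, and `a(0,1,4) = 1`. -/
def IsNormalized (a : Triple → ℂ) : Prop :=
  (∀ t : Triple, t.val.2.2 ≤ 3 → a t = 1) ∧ a t014 = 1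

/-- `F(a,b)(i,j,k) = a(i,j,k)·bᵢ·bⱼ·b_k`. -/
def F (a : Triple → ℂ) (b : Fin 5 → ℂ) (t : Triple) : ℂ :=
  a t * b t.val.1 * b t.val.2.1 * b t.val.2.2

/-- (1) the map `(a,b) ↦ F(a,b)` from `𝒜` is injective up to a scalar:
if `F(a,b) = λ·F(a′,b′)` with `λ ≠ 0` then `a = a′` and `b = μ·b′` for some `μ ≠ 0`;
(2) it is surjective up to a scalar onto the functions `A` on triples with `A(i,j,k) ≠ 0`
whenever `k ≤ 3` and `A(0,1,4) ≠ 0`. -/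
theorem pentahedron_normal_form :
    (∀ (a a' : Triple → ℂ) (b b' : Fin 5 → ℂ) (l : ℂ),
      IsNormalized a → IsNormalized a' →
      (∀ i, b i ≠ 0) → (∀ i, b' i ≠ 0) → l ≠ 0 →
      (∀ t, F a b t = l * F a' b' t) →
      a = a' ∧ ∃ μ : ℂ, μ ≠ 0 ∧ ∀ i, b i = μ * b' i) ∧
    (∀ A : Triple → ℂ,
      (∀ t : Triple, t.val.2.2 ≤ 3 → A t ≠ 0) → A t014 ≠ 0 →
      ∃ (a : Triple → ℂ) (b : Fin 5 → ℂ) (l : ℂ),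
        IsNormalized a ∧ (∀ i, b i ≠ 0) ∧ l ≠ 0 ∧ ∀ t, A t = l * F a b t) := by
  constructor
  · intro a a' b b' l ha ha' hb hb' hl h
    obtain ⟨c, hc⟩ : ∃ c : Fin 5 → ℂ, ∀ i, b i = c i * b' i :=
      ⟨fun i => b i / b' i, fun i => (div_mul_cancel₀ _ (hb' i)).symm⟩
    have hc0 : ∀ i, c i ≠ 0 := by
      intro i h0
      apply hb i
      rw [hc i, h0, zero_mul]
    have key : ∀ t : Triple, a t = 1 → a' t = 1 →
        c t.val.1 * c t.val.2.1 * c t.val.2.2 = l := by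
      intro t h1 h2
      have h3 := h t
      simp only [F, h1, h2, hc] at h3
      have h4 : b' t.val.1 * b' t.val.2.1 * b' t.val.2.2 ≠ 0 :=
        mul_ne_zero (mul_ne_zero (hb' _) (hb' _)) (hb' _)
      apply mul_right_cancel₀ h4
      linear_combination h3
    have key' : ∀ t : Triple, t.val.2.2 ≤ 3 →
        c t.val.1 * c t.val.2.1 * c t.val.2.2 = l :=
      fun t ht => key t (ha.1 t ht) (ha'.1 t ht)
    have e012 : c 0 * c 1 * c 2 = l := key' ⟨(0, 1, 2), by decide⟩ (by decide)
    have e013 : c 0 * c 1 * c 3 = l := key' ⟨(0, 1, 3), by decide⟩ (by decide)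
    have e023 : c 0 * c 2 * c 3 = l := key' ⟨(0, 2, 3), by decide⟩ (by decide)
    have e123 : c 1 * c 2 * c 3 = l := key' ⟨(1, 2, 3), by decide⟩ (by decide)
    have e014 : c 0 * c 1 * c 4 = l := key t014 ha.2 ha'.2
    have h3 : c 3 = c 0 := by
      apply mul_left_cancel₀ (mul_ne_zero (hc0 1) (hc0 2))
      linear_combination e123 - e012
    have h2 : c 2 = c 0 := by
      rw [← h3]
      apply mul_left_cancel₀ (mul_ne_zero (hc0 0) (hc0 1))
      linear_combination e012 - e013
    have h1 : c 1 = c 0 := by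
      rw [← h2]
      apply mul_left_cancel₀ (mul_ne_zero (hc0 0) (hc0 3))
      linear_combination e013 - e023
    have h4 : c 4 = c 0 := by
      rw [← h2]
      apply mul_left_cancel₀ (mul_ne_zero (hc0 0) (hc0 1))
      linear_combination e014 - e012
    have hall : ∀ i, c i = c 0 := by
      intro i
      fin_cases i
      · rfl
      · exact h1
      · exact h2
      · exact h3
      · exact h4
    refine ⟨?_, c 0, hc0 0, fun i => by rw [hc i, hall i]⟩
    funext t
    have h5 := h t
    have hl3 : l = c 0 * c 0 * c 0 := by rw [← e012, h1, h2]
    simp only [F, hc, hl3] at h5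
    rw [hall t.val.1, hall t.val.2.1, hall t.val.2.2] at h5
    have h6 : c 0 * c 0 * c 0 * (b' t.val.1 * b' t.val.2.1 * b' t.val.2.2) ≠ 0 :=
      mul_ne_zero (mul_ne_zero (mul_ne_zero (hc0 _) (hc0 _)) (hc0 _))
        (mul_ne_zero (mul_ne_zero (hb' _) (hb' _)) (hb' _))
    apply mul_right_cancel₀ h6
    linear_combination h5
  · intro A hA hA4
    obtain ⟨p, hp⟩ : ∃ p, p = A ⟨(0, 1, 2), by decide⟩ := ⟨_, rfl⟩
    obtain ⟨q, hq⟩ : ∃ q, q = A ⟨(0, 1, 3), by decide⟩ := ⟨_, rfl⟩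
    obtain ⟨r, hr⟩ : ∃ r, r = A ⟨(0, 2, 3), by decide⟩ := ⟨_, rfl⟩
    obtain ⟨s, hs⟩ : ∃ s, s = A ⟨(1, 2, 3), by decide⟩ := ⟨_, rfl⟩
    obtain ⟨w, hw⟩ : ∃ w, w = A t014 := ⟨_, rfl⟩
    have p0 : p ≠ 0 := hp ▸ hA _ (by decide)
    have q0 : q ≠ 0 := hq ▸ hA _ (by decide)
    have r0 : r ≠ 0 := hr ▸ hA _ (by decide)
    have s0 : s ≠ 0 := hs ▸ hA _ (by decide)
    have w0 : w ≠ 0 := hw ▸ hA4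
    obtain ⟨b, hb⟩ : ∃ b : Fin 5 → ℂ, b = ![1 / s, 1 / r, 1 / q, 1 / p, w / (p * q)] :=
      ⟨_, rfl⟩
    have b0 : b 0 = 1 / s := by rw [hb]; rfl
    have b1 : b 1 = 1 / r := by rw [hb]; rfl
    have b2 : b 2 = 1 / q := by rw [hb]; rfl
    have b3 : b 3 = 1 / p := by rw [hb]; rfl
    have b4 : b 4 = w / (p * q) := by rw [hb]; rfl
    have hb0 : ∀ i, b i ≠ 0 := by
      intro i
      fin_cases i
      · change b 0 ≠ 0
        rw [b0]; exact one_div_ne_zero s0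
      · change b 1 ≠ 0
        rw [b1]; exact one_div_ne_zero r0
      · change b 2 ≠ 0
        rw [b2]; exact one_div_ne_zero q0
      · change b 3 ≠ 0
        rw [b3]; exact one_div_ne_zero p0
      · change b 4 ≠ 0
        rw [b4]; exact div_ne_zero w0 (mul_ne_zero p0 q0)
    have l0 : p * q * r * s ≠ 0 := mul_ne_zero (mul_ne_zero (mul_ne_zero p0 q0) r0) s0
    have d0 : ∀ t : Triple,
        p * q * r * s * (b t.val.1 * b t.val.2.1 * b t.val.2.2) ≠ 0 := fun t =>
      mul_ne_zero l0 (mul_ne_zero (mul_ne_zero (hb0 _) (hb0 _)) (hb0 _))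
    refine ⟨fun t => A t / (p * q * r * s * (b t.val.1 * b t.val.2.1 * b t.val.2.2)), b,
      p * q * r * s, ⟨?_, ?_⟩, hb0, l0, ?_⟩
    · intro t ht
      rw [div_eq_one_iff_eq (d0 t)]
      have cases4 : ∀ x : Fin 5 × Fin 5 × Fin 5, x.1 < x.2.1 ∧ x.2.1 < x.2.2 → x.2.2 ≤ 3 →
          x = (0, 1, 2) ∨ x = (0, 1, 3) ∨ x = (0, 2, 3) ∨ x = (1, 2, 3) := by
        rintro ⟨i, j, k⟩ ⟨h1, h2⟩ h3
        simp only [Prod.mk.injEq, Fin.ext_iff, Fin.lt_def, Fin.le_def] at *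
        simp at *
        omega
      obtain ⟨x, hx⟩ := t
      rcases cases4 x hx ht with rfl | rfl | rfl | rfl
      · rw [← hp]
        change p = p * q * r * s * (b 0 * b 1 * b 2)
        rw [b0, b1, b2]; field_simp
      · rw [← hq]
        change q = p * q * r * s * (b 0 * b 1 * b 3)
        rw [b0, b1, b3]; field_simp
      · rw [← hr]
        change r = p * q * r * s * (b 0 * b 2 * b 3)
        rw [b0, b2, b3]; field_simp
      · rw [← hs]
        change s = p * q * r * s * (b 1 * b 2 * b 3)
        rw [b1, b2, b3]; field_simp
    · rw [div_eq_one_iff_eq (d0 t014), ← hw]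
      change w = p * q * r * s * (b 0 * b 1 * b 4)
      rw [b0, b1, b4]; field_simp
    · intro t
      have h1 := div_mul_cancel₀ (A t) (d0 t)
      simp only [F]
      linear_combination -h1
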